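/- Let α, β, d₂ ∈ ℝ, let x₀ < x₁, and let u₁, u₂ : ℝ × [x₀, x₁] → ℝ be continuously differentiable in t and twice continuously differentiable in x, with all these partial derivatives jointly continuous. Assume that on ℝ × [x₀, x₁] they satisfy ∂ₜu₁ = ∂ₓ²u₁ + d₂∂ₓ²u₂ + f(u₁,u₂) and ∂ₜu₂ = ∂ₓ²u₂ − f(u₁,u₂), where f(u₁,u₂) = αu₁ − u₁³ + βu₁u₂, and that the homogeneous Neumann boundary conditions ∂ₓu₁(t,x₀) = ∂ₓu₁(t,x₁) = ∂ₓu₂(t,x₀) = ∂ₓu₂(t,x₁) = 0 hold for all t. Then the total mass t ↦ ∫_{x₀}^{x₁} (u₁(t,x) + u₂(t,x)) dx is constant in t. -/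

import Mathlib

/-- Differentiation under the integral sign over a compact interval, for an integrand whose
derivative in the parameter is jointly continuous. -/
theorem hasDerivAt_intervalIntegral_of_continuousOn {a b : ℝ} (hab : a ≤ b) {w w' : ℝ → ℝ → ℝ}
    (hw : ∀ t, ContinuousOn (w t) (Set.Icc a b))
    (hw' : ContinuousOn (fun p : ℝ × ℝ => w' p.1 p.2) (Set.univ ×ˢ Set.Icc a b))
    (hd : ∀ t, ∀ x ∈ Set.Icc a b, HasDerivAt (fun s => w s x) (w' t x) t) (t : ℝ) :
    HasDerivAt (fun s => ∫ x in a..b, w s x) (∫ x in a..b, w' t x) t := by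
  have hsub : Set.uIoc a b ⊆ Set.Icc a b := by
    rw [Set.uIoc_of_le hab]
    exact Set.Ioc_subset_Icc_self
  have hslice : ContinuousOn (w' t) (Set.Icc a b) :=
    hw'.comp (f := fun x => (t, x)) (by fun_prop) fun x hx => ⟨Set.mem_univ _, hx⟩
  obtain ⟨C, hC⟩ := (isCompact_Icc.prod isCompact_Icc).exists_bound_of_continuousOn
    (hw'.mono (Set.prod_mono (Set.subset_univ (Set.Icc (t - 1) (t + 1))) subset_rfl))
  refine (intervalIntegral.hasDerivAt_integral_of_dominated_loc_of_deriv_le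
    (bound := fun _ => C) (Icc_mem_nhds (sub_one_lt t) (lt_add_one t))
    (Filter.Eventually.of_forall fun s => ?_)
    (hw t |>.intervalIntegrable_of_Icc hab) ?_ ?_ intervalIntegrable_const ?_).2
  · exact ((hw s).mono hsub).aestronglyMeasurable measurableSet_uIoc
  · exact (hslice.mono hsub).aestronglyMeasurable measurableSet_uIoc
  · exact Filter.Eventually.of_forall fun x hx s hs => hC (s, x) ⟨hs, hsub hx⟩
  · exact Filter.Eventually.of_forall fun x hx s _ => hd s x (hsub hx)

/-- The integral of the derivative of a function vanishing at both endpoints is zero. -/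
theorem intervalIntegral_eq_zero_of_hasDerivWithinAt {a b : ℝ} (hab : a ≤ b) {g g' : ℝ → ℝ}
    (hg : ∀ x ∈ Set.Icc a b, HasDerivWithinAt g (g' x) (Set.Icc a b) x)
    (hg' : ContinuousOn g' (Set.Icc a b)) (ha : g a = 0) (hb : g b = 0) :
    ∫ x in a..b, g' x = 0 := by
  rw [intervalIntegral.integral_eq_sub_of_hasDerivAt_of_le hab
    (fun x hx => (hg x hx).continuousWithinAt)
    (fun x hx => (hg x (Set.Ioo_subset_Icc_self hx)).hasDerivAt (Icc_mem_nhds hx.1 hx.2))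
    (hg'.intervalIntegrable_of_Icc hab), ha, hb, sub_zero]

/-- mass conservation for the reaction–diffusion system
`∂ₜu₁ = ∂ₓ²u₁ + d₂∂ₓ²u₂ + f(u₁,u₂)`, `∂ₜu₂ = ∂ₓ²u₂ − f(u₁,u₂)` with
`f(u₁,u₂) = αu₁ − u₁³ + βu₁u₂` and homogeneous Neumann boundary conditions on
`[x₀,x₁]`: the total mass `t ↦ ∫_{x₀}^{x₁} (u₁(t,x)+u₂(t,x)) dx` is constant.
The partial derivatives `u₁t = ∂ₜu₁`, `u₁x = ∂ₓu₁`, `u₁xx = ∂ₓ²u₁` (and likewise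
for `u₂`) are given as functions, required to be derivatives (in `x` within
`[x₀,x₁]`) and jointly continuous on `ℝ × [x₀,x₁]`. -/
theorem mass_conservation (α β d₂ x₀ x₁ : ℝ) (hx : x₀ < x₁)
    (u₁ u₂ u₁t u₂t u₁x u₂x u₁xx u₂xx : ℝ → ℝ → ℝ)
    (h₁t : ∀ t x, x ∈ Set.Icc x₀ x₁ → HasDerivAt (fun s => u₁ s x) (u₁t t x) t)
    (h₂t : ∀ t x, x ∈ Set.Icc x₀ x₁ → HasDerivAt (fun s => u₂ s x) (u₂t t x) t)
    (h₁x : ∀ t x, x ∈ Set.Icc x₀ x₁ →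
      HasDerivWithinAt (fun y => u₁ t y) (u₁x t x) (Set.Icc x₀ x₁) x)
    (h₂x : ∀ t x, x ∈ Set.Icc x₀ x₁ →
      HasDerivWithinAt (fun y => u₂ t y) (u₂x t x) (Set.Icc x₀ x₁) x)
    (h₁xx : ∀ t x, x ∈ Set.Icc x₀ x₁ →
      HasDerivWithinAt (fun y => u₁x t y) (u₁xx t x) (Set.Icc x₀ x₁) x)
    (h₂xx : ∀ t x, x ∈ Set.Icc x₀ x₁ →
      HasDerivWithinAt (fun y => u₂x t y) (u₂xx t x) (Set.Icc x₀ x₁) x)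
    (hcont : ∀ v ∈ [u₁, u₂, u₁t, u₂t, u₁x, u₂x, u₁xx, u₂xx],
      ContinuousOn (fun p : ℝ × ℝ => v p.1 p.2) (Set.univ ×ˢ Set.Icc x₀ x₁))
    (hpde₁ : ∀ t x, x ∈ Set.Icc x₀ x₁ →
      u₁t t x = u₁xx t x + d₂ * u₂xx t x
        + (α * u₁ t x - (u₁ t x) ^ 3 + β * u₁ t x * u₂ t x))
    (hpde₂ : ∀ t x, x ∈ Set.Icc x₀ x₁ →
      u₂t t x = u₂xx t x
        - (α * u₁ t x - (u₁ t x) ^ 3 + β * u₁ t x * u₂ t x))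
    (hbc : ∀ t, u₁x t x₀ = 0 ∧ u₁x t x₁ = 0 ∧ u₂x t x₀ = 0 ∧ u₂x t x₁ = 0) :
    ∀ t t' : ℝ,
      (∫ x in x₀..x₁, (u₁ t x + u₂ t x)) = ∫ x in x₀..x₁, (u₁ t' x + u₂ t' x) := by
  have hslice : ∀ v ∈ [u₁, u₂, u₁t, u₂t, u₁x, u₂x, u₁xx, u₂xx], ∀ t,
      ContinuousOn (v t) (Set.Icc x₀ x₁) := fun v hv t =>
    (hcont v hv).comp (f := fun x => (t, x)) (by fun_prop) fun x hx => ⟨Set.mem_univ _, hx⟩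
  have hderiv : ∀ t, HasDerivAt (fun s => ∫ x in x₀..x₁, (u₁ s x + u₂ s x)) 0 t := by
    intro t
    have hflux : ∫ x in x₀..x₁, (u₁t t x + u₂t t x) = 0 := by
      obtain ⟨h₁l, h₁r, h₂l, h₂r⟩ := hbc t
      rw [← intervalIntegral_eq_zero_of_hasDerivWithinAt hx.le
        (g := fun x => u₁x t x + (d₂ + 1) * u₂x t x)
        (g' := fun x => u₁xx t x + (d₂ + 1) * u₂xx t x)
        (fun x hx' => (h₁xx t x hx').add ((h₂xx t x hx').const_mul (d₂ + 1)))
        ((hslice u₁xx (by simp) t).add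
          (continuousOn_const.mul (hslice u₂xx (by simp) t)))
        (by simp [h₁l, h₂l]) (by simp [h₁r, h₂r])]
      refine intervalIntegral.integral_congr fun x hx' => ?_
      rw [Set.uIcc_of_le hx.le] at hx'
      simp only [hpde₁ t x hx', hpde₂ t x hx']
      ring
    rw [← hflux]
    exact hasDerivAt_intervalIntegral_of_continuousOn hx.le
      (w := fun t x => u₁ t x + u₂ t x) (w' := fun t x => u₁t t x + u₂t t x)
      (fun s => (hslice u₁ (by simp) s).add (hslice u₂ (by simp) s))
      ((hcont u₁t (by simp)).add (hcont u₂t (by simp)))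
      (fun s x hx' => (h₁t s x hx').add (h₂t s x hx')) t
  exact is_const_of_deriv_eq_zero (fun t => (hderiv t).differentiableAt) fun t => (hderiv t).deriv
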